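/- Fix r ≥ 1 and work in the polynomial ring ℤ[X_1,…,X_r,Z_1,…,Z_r]. Let R(X,Z) = ∑_{σ ∈ S_r} sgn(σ) ∏_{l=1}^r ∏_{j ∈ {1,…,r}, j ≠ σ(l)} (X_j − Z_l). Then the coefficient of the monomial ∏_{i=1}^r X_i^{i−1} Z_i^{i−1} in R(X,Z) equals (−1)^{r(r−1)/2}. -/

import Mathlib

open Finset in
lemma aux_diag {A : Type*} [CommRing A] (r : ℕ) (x : Fin r → A) :
    ∏ j : Fin r, ∏ k ∈ univ.erase j, (x k - x j) =
      (-1) ^ (r * (r - 1) / 2) * (Matrix.vandermonde x).det * (Matrix.vandermonde x).det := by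
  have h1 : ∀ j : Fin r, ∏ k ∈ univ.erase j, (x k - x j) =
      (∏ k ∈ Ioi j, (x k - x j)) * ∏ k ∈ Iio j, (x k - x j) := by
    intro j
    rw [← Finset.prod_union]
    · congr 1
      ext k
      simp only [mem_erase, mem_univ, and_true, mem_union, mem_Ioi, mem_Iio]
      rw [ne_iff_lt_or_gt, or_comm]
    · rw [Finset.disjoint_left]
      intro k hk hk'
      simp only [mem_Ioi, mem_Iio] at hk hk'
      exact absurd hk (not_lt.mpr hk'.le)
  have h2 : ∏ j : Fin r, ∏ k ∈ Iio j, (x k - x j) =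
      ∏ k : Fin r, ∏ j ∈ Ioi k, (x k - x j) := by
    apply Finset.prod_comm'
    intro a b
    simp
  have h3 : ∀ k : Fin r, ∏ j ∈ Ioi k, (x k - x j) =
      (-1) ^ (r - 1 - (k : ℕ)) * ∏ j ∈ Ioi k, (x j - x k) := by
    intro k
    have : ∀ j ∈ Ioi k, x k - x j = (-1) * (x j - x k) := by intro j _; ring
    rw [Finset.prod_congr rfl this, Finset.prod_mul_distrib, Finset.prod_const, Fin.card_Ioi]
  have h4 : ∑ k : Fin r, (r - 1 - (k : ℕ)) = r * (r - 1) / 2 := by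
    rw [Fin.sum_univ_eq_sum_range (fun k => r - 1 - k) r, Finset.sum_range_reflect (fun k => k) r,
      Finset.sum_range_id]
  rw [Finset.prod_congr rfl (fun j _ => h1 j), Finset.prod_mul_distrib, h2,
    Finset.prod_congr rfl (fun j _ => h3 j), Finset.prod_mul_distrib, Finset.prod_pow_eq_pow_sum,
    h4, Matrix.det_vandermonde]
  ring

open Finset Polynomial in
lemma aux_factor {A : Type*} [CommRing A] (r : ℕ) (x z : Fin r → A) :
    (Matrix.of fun l j : Fin r => ∏ k ∈ univ.erase j, (x k - z l)) =
      Matrix.vandermonde z * Matrix.of fun m j : Fin r =>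
        (∏ k ∈ univ.erase j, (C (x k) - X : A[X])).coeff m := by
  ext l j
  have hd : (∏ k ∈ univ.erase j, (C (x k) - X : A[X])).natDegree < r := by
    have h := Polynomial.natDegree_prod_le (univ.erase j) (fun k => (C (x k) - X : A[X]))
    have h' : ∑ k ∈ univ.erase j, (C (x k) - X : A[X]).natDegree ≤ ∑ k ∈ univ.erase j, 1 := by
      apply Finset.sum_le_sum
      intro k _
      exact (natDegree_sub_le _ _).trans (by simp [natDegree_X_le])
    have hc : (univ.erase j).card = r - 1 := by simp
    have := j.2
    simp only [sum_const, hc, smul_eq_mul, mul_one] at h'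
    omega
  have he := Polynomial.eval_eq_sum_range' hd (z l)
  rw [Polynomial.eval_prod] at he
  simp only [eval_sub, eval_C, eval_X] at he
  rw [Matrix.mul_apply, Matrix.of_apply, he, ← Fin.sum_univ_eq_sum_range
    (fun i => (∏ k ∈ univ.erase j, (C (x k) - X : A[X])).coeff i * z l ^ i) r]
  simp [Matrix.vandermonde_apply, mul_comm]

open Finset in
lemma aux_det {A : Type*} [CommRing A] [IsDomain A] (r : ℕ) (x z : Fin r → A)
    (hx : Function.Injective x) :
    (Matrix.of fun l j : Fin r => ∏ k ∈ univ.erase j, (x k - z l)).det =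
      (-1) ^ (r * (r - 1) / 2) * ((Matrix.vandermonde x).det * (Matrix.vandermonde z).det) := by
  have hd : (Matrix.of fun l j : Fin r => ∏ k ∈ univ.erase j, (x k - x l)).det =
      ∏ j : Fin r, ∏ k ∈ univ.erase j, (x k - x j) := by
    rw [← Matrix.det_diagonal]
    congr 1
    ext l j
    rw [Matrix.of_apply, Matrix.diagonal_apply]
    split_ifs with h
    · rw [h]
    · exact Finset.prod_eq_zero (i := l) (by simp [h]) (sub_self _)
  rw [aux_diag, aux_factor, Matrix.det_mul] at hd
  have hv : (Matrix.vandermonde x).det ≠ 0 := Matrix.det_vandermonde_ne_zero_iff.mpr hx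
  rw [mul_comm] at hd
  have hC := mul_right_cancel₀ hv hd
  rw [aux_factor, Matrix.det_mul, hC]
  ring

open Finset MvPolynomial in
lemma aux_coeff (r : ℕ) :
    MvPolynomial.coeff
      (Finsupp.equivFunOnFinite.symm
        (Sum.elim (fun i : Fin r => (i : ℕ)) (fun i : Fin r => (i : ℕ))))
      ((Matrix.vandermonde fun i : Fin r =>
          (X (Sum.inl i) : MvPolynomial (Fin r ⊕ Fin r) ℤ)).det *
        (Matrix.vandermonde fun i : Fin r =>
          (X (Sum.inr i) : MvPolynomial (Fin r ⊕ Fin r) ℤ)).det) = 1 := by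
  have hmon : ∀ σ τ : Equiv.Perm (Fin r),
      (∏ i, (X (Sum.inl i) : MvPolynomial (Fin r ⊕ Fin r) ℤ) ^ ((σ i : Fin r) : ℕ)) *
        (∏ i, (X (Sum.inr i) : MvPolynomial (Fin r ⊕ Fin r) ℤ) ^ ((τ i : Fin r) : ℕ)) =
      monomial (Finsupp.equivFunOnFinite.symm
        (Sum.elim (fun i : Fin r => (σ i : ℕ)) (fun i : Fin r => (τ i : ℕ)))) 1 := by
    intro σ τ
    rw [MvPolynomial.monomial_eq, Finsupp.prod_fintype _ _ (by simp)]
    simp [Fintype.prod_sum_type]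
  have hkey : ∀ σ τ : Equiv.Perm (Fin r),
      (Finsupp.equivFunOnFinite.symm
        (Sum.elim (fun i : Fin r => (σ i : ℕ)) (fun i : Fin r => (τ i : ℕ))) =
      Finsupp.equivFunOnFinite.symm
        (Sum.elim (fun i : Fin r => (i : ℕ)) (fun i : Fin r => (i : ℕ)))) ↔ (σ = 1 ∧ τ = 1) := by
    intro σ τ
    constructor
    · intro h
      have h := Finsupp.equivFunOnFinite.symm.injective h
      constructor
      · ext i; simpa using congrFun h (Sum.inl i)
      · ext i; simpa using congrFun h (Sum.inr i)
    · rintro ⟨rfl, rfl⟩; simp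
  rw [← Matrix.det_transpose, ← Matrix.det_transpose (Matrix.vandermonde fun i : Fin r =>
          (X (Sum.inr i) : MvPolynomial (Fin r ⊕ Fin r) ℤ)), Matrix.det_apply', Matrix.det_apply',
    Finset.sum_mul_sum]
  simp only [Matrix.transpose_apply, Matrix.vandermonde_apply]
  have hterm : ∀ σ τ : Equiv.Perm (Fin r),
      MvPolynomial.coeff (Finsupp.equivFunOnFinite.symm
        (Sum.elim (fun i : Fin r => (i : ℕ)) (fun i : Fin r => (i : ℕ))))
      (((Equiv.Perm.sign σ : ℤ) : MvPolynomial (Fin r ⊕ Fin r) ℤ) *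
        (∏ i, (X (Sum.inl i) : MvPolynomial (Fin r ⊕ Fin r) ℤ) ^ ((σ i : Fin r) : ℕ)) *
       (((Equiv.Perm.sign τ : ℤ) : MvPolynomial (Fin r ⊕ Fin r) ℤ) *
        (∏ i, (X (Sum.inr i) : MvPolynomial (Fin r ⊕ Fin r) ℤ) ^ ((τ i : Fin r) : ℕ)))) =
      if σ = 1 ∧ τ = 1 then 1 else 0 := by
    intro σ τ
    rw [mul_mul_mul_comm, hmon, ← Int.cast_mul, ← map_intCast (C : ℤ →+* MvPolynomial (Fin r ⊕ Fin r) ℤ), Int.cast_id,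
      MvPolynomial.coeff_C_mul, MvPolynomial.coeff_monomial]
    simp only [hkey]
    split_ifs with h
    · rw [h.1, h.2]; simp
    · simp
  simp only [MvPolynomial.coeff_sum, hterm]
  rw [Finset.sum_eq_single 1, Finset.sum_eq_single 1] <;> simp +contextual

/-- The coefficient of ∏ X_i^{i-1} Z_i^{i-1} in R(X,Z) is (-1)^{r(r-1)/2}. -/
theorem stmt_4 (r : ℕ) (hr : 1 ≤ r) :
    MvPolynomial.coeff
      (Finsupp.equivFunOnFinite.symm
        (Sum.elim (fun i : Fin r => (i : ℕ)) (fun i : Fin r => (i : ℕ))))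
      (∑ σ : Equiv.Perm (Fin r),
        ((Equiv.Perm.sign σ : ℤ) : MvPolynomial (Fin r ⊕ Fin r) ℤ) *
          ∏ l : Fin r, ∏ j ∈ Finset.univ.erase (σ l),
            (MvPolynomial.X (Sum.inl j) - MvPolynomial.X (Sum.inr l))) =
      (-1 : ℤ) ^ (r * (r - 1) / 2) := by
  have h := aux_det r (fun i => (MvPolynomial.X (Sum.inl i) : MvPolynomial (Fin r ⊕ Fin r) ℤ))
    (fun i => MvPolynomial.X (Sum.inr i))
    (fun a b hab => Sum.inl_injective (MvPolynomial.X_injective hab))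
  rw [← Matrix.det_transpose, Matrix.det_apply'] at h
  simp only [Matrix.transpose_apply, Matrix.of_apply] at h
  rw [h]
  have hc : ((-1) ^ (r * (r - 1) / 2) : MvPolynomial (Fin r ⊕ Fin r) ℤ) =
      MvPolynomial.C ((-1) ^ (r * (r - 1) / 2)) := by simp
  rw [hc, MvPolynomial.coeff_C_mul, aux_coeff, mul_one]
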